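/- Fix real κ, v̄, ρ, v₀, r, t > 0, S₀ > 0, and u ∈ ℂ with u ≠ 0. For σ ∈ ℝ, σ ≠ 0, define ξ(σ) := κ − σρiu, d(σ) := (ξ(σ)² + σ²(u²+iu))^{1/2} (principal square root), A₁, A₂, A := A₁/A₂, X := (d+ξ)/2 + ((d−ξ)/2)e^{−dt}, D := Log d + (κ−d)t/2 − Log X, and φ(σ) := exp( iu(log S₀ + rt) − tκv̄ρiu/σ − v₀·A + (2κv̄/σ²)·D ). Suppose at σ₀ ≠ 0: ξ(σ₀)² + σ₀²(u²+iu) ∉ (−∞, 0], d(σ₀) ∉ (−∞, 0], X(σ₀) ∉ (−∞, 0], ξ(σ₀) ≠ 0 and A₂(σ₀) ≠ 0. Then σ ↦ φ(σ) is differentiable at σ₀ with derivative φ(σ₀)·h₅, where h₅ := −v₀·Aσ' − (4κv̄/σ₀³)·D + (2κv̄/(σ₀²d))·( dσ' − (d/A₂)·A₂σ' ) + tκv̄ρiu/σ₀², with dσ' := (−ξρiu + σ₀(u²+iu))/d, A₁σ' := ((u²+iu)t/2)·dσ'·cosh(dt/2), A₂σ' := (ρ/σ₀)·A₂ρ' −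 ((2+tξ)/(iutξ))·A₁ρ' + σ₀tA₁/2, Aσ' := (1/A₂)A₁σ' − (A/A₂)A₂σ', where A₁ρ' := −iu(u²+iu)tξσ₀ cosh(dt/2)/(2d) and A₂ρ' := −σ₀iu(2+tξ)(ξ cosh(dt/2)+d sinh(dt/2))/(2d), all evaluated at σ₀. -/

import Mathlib

noncomputable section

/-- Principal complex square root `z^{1/2} := exp((1/2)·Log z)`. -/
def csqrt (z : ℂ) : ℂ := Complex.exp ((1 / 2 : ℂ) * Complex.log z)

/-- `ξ(σ) := κ − σρiu`. -/
def ξf (κ ρ : ℝ) (u : ℂ) (σ : ℝ) : ℂ := (κ : ℂ) - (σ : ℂ) * (ρ : ℂ) * Complex.I * u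

/-- `d(σ) := (ξ(σ)² + σ²(u²+iu))^{1/2}` (principal square root). -/
def df (κ ρ : ℝ) (u : ℂ) (σ : ℝ) : ℂ :=
  csqrt ((ξf κ ρ u σ) ^ 2 + (σ : ℂ) ^ 2 * (u ^ 2 + Complex.I * u))

/-- `A₁(σ) := (u²+iu)·sinh(d(σ)t/2)`. -/
def A₁f (κ ρ t : ℝ) (u : ℂ) (σ : ℝ) : ℂ :=
  (u ^ 2 + Complex.I * u) * Complex.sinh (df κ ρ u σ * (t : ℂ) / 2)

/-- `A₂(σ) := d(σ)·cosh(d(σ)t/2) + ξ(σ)·sinh(d(σ)t/2)`. -/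
def A₂f (κ ρ t : ℝ) (u : ℂ) (σ : ℝ) : ℂ :=
  df κ ρ u σ * Complex.cosh (df κ ρ u σ * (t : ℂ) / 2) +
    ξf κ ρ u σ * Complex.sinh (df κ ρ u σ * (t : ℂ) / 2)

/-- `A(σ) := A₁(σ)/A₂(σ)`. -/
def Af (κ ρ t : ℝ) (u : ℂ) (σ : ℝ) : ℂ := A₁f κ ρ t u σ / A₂f κ ρ t u σ

/-- `X(σ) := (d+ξ)/2 + ((d−ξ)/2)·e^{−dt}`. -/
def Xf (κ ρ t : ℝ) (u : ℂ) (σ : ℝ) : ℂ :=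
  (df κ ρ u σ + ξf κ ρ u σ) / 2 +
    (df κ ρ u σ - ξf κ ρ u σ) / 2 * Complex.exp (-(df κ ρ u σ * (t : ℂ)))

/-- `D(σ) := Log d + (κ−d)t/2 − Log X`. -/
def Dfn (κ ρ t : ℝ) (u : ℂ) (σ : ℝ) : ℂ :=
  Complex.log (df κ ρ u σ) + ((κ : ℂ) - df κ ρ u σ) * (t : ℂ) / 2 -
    Complex.log (Xf κ ρ t u σ)

/-- The Cui representation `φ(σ)` of the Heston characteristic function as a function of `σ`. -/
def φf (κ vb ρ v₀ r t S₀ : ℝ) (u : ℂ) (σ : ℝ) : ℂ :=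
  Complex.exp (Complex.I * u * ((Real.log S₀ : ℂ) + (r : ℂ) * (t : ℂ))
    - (t : ℂ) * (κ : ℂ) * (vb : ℂ) * (ρ : ℂ) * Complex.I * u / (σ : ℂ)
    - (v₀ : ℂ) * Af κ ρ t u σ + (2 * (κ : ℂ) * (vb : ℂ) / (σ : ℂ) ^ 2) * Dfn κ ρ t u σ)

lemma csqrt_sq {z : ℂ} (hz : z ≠ 0) : csqrt z ^ 2 = z := by
  rw [csqrt, ← Complex.exp_nat_mul]
  rw [show ((2 : ℕ) : ℂ) * (1 / 2 * Complex.log z) = Complex.log z by push_cast; ring]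
  exact Complex.exp_log hz

lemma csqrt_ne_zero (z : ℂ) : csqrt z ≠ 0 := Complex.exp_ne_zero _

lemma hasDerivAt_csqrt {z : ℂ} (hz : z ∈ Complex.slitPlane) :
    HasDerivAt csqrt (1 / (2 * csqrt z)) z := by
  have h := ((Complex.hasDerivAt_log hz).const_mul (1 / 2 : ℂ)).cexp
  refine h.congr_deriv ?_
  change csqrt z * (1 / 2 * z⁻¹) = _
  have h0 := csqrt_ne_zero z
  nth_rewrite 2 [← csqrt_sq (Complex.slitPlane_ne_zero hz)]
  field_simp

lemma hasDerivAt_ξf (κ ρ : ℝ) (u : ℂ) (σ : ℝ) :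
    HasDerivAt (ξf κ ρ u) (-((ρ : ℂ) * Complex.I * u)) σ := by
  have h : HasDerivAt (fun x : ℝ => (x : ℂ)) 1 σ := Complex.ofRealCLM.hasDerivAt
  exact ((((h.mul_const (ρ : ℂ)).mul_const Complex.I).mul_const u).const_sub (κ : ℂ)).congr_deriv
    (by ring)

lemma hasDerivAt_df {κ ρ : ℝ} {u : ℂ} {σ : ℝ}
    (hw : (ξf κ ρ u σ) ^ 2 + (σ : ℂ) ^ 2 * (u ^ 2 + Complex.I * u) ∈ Complex.slitPlane) :
    HasDerivAt (df κ ρ u) ((-(ξf κ ρ u σ) * (ρ : ℂ) * Complex.I * u +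
      (σ : ℂ) * (u ^ 2 + Complex.I * u)) / df κ ρ u σ) σ := by
  have h : HasDerivAt (fun x : ℝ => (x : ℂ)) 1 σ := Complex.ofRealCLM.hasDerivAt
  have hq := ((hasDerivAt_ξf κ ρ u σ).pow 2).add
    ((h.pow 2).mul_const (u ^ 2 + Complex.I * u))
  refine ((hasDerivAt_csqrt hw).comp σ hq).congr_deriv ?_
  have h0 : df κ ρ u σ ≠ 0 := csqrt_ne_zero _
  change 1 / (2 * df κ ρ u σ) * _ = _
  norm_num only [Nat.cast_ofNat, pow_one]
  field_simp

lemma Xf_eq_A₂f_mul_exp (κ ρ t : ℝ) (u : ℂ) (σ : ℝ) :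
    Xf κ ρ t u σ = A₂f κ ρ t u σ * Complex.exp (-(df κ ρ u σ * (t : ℂ) / 2)) := by
  have h1 : Complex.exp (-(df κ ρ u σ * (t : ℂ))) =
      Complex.exp (-(df κ ρ u σ * (t : ℂ) / 2)) ^ 2 := by
    rw [← Complex.exp_nat_mul]; congr 1; push_cast; ring
  have h2 : Complex.exp (df κ ρ u σ * (t : ℂ) / 2) *
      Complex.exp (-(df κ ρ u σ * (t : ℂ) / 2)) = 1 := by
    rw [← Complex.exp_add, add_neg_cancel, Complex.exp_zero]
  rw [Xf, A₂f, Complex.cosh, Complex.sinh, h1]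
  linear_combination (-(df κ ρ u σ + ξf κ ρ u σ) / 2) * h2

lemma hasDerivAt_A₁f {κ ρ t : ℝ} {u : ℂ} {σ : ℝ} {d' : ℂ} (h : HasDerivAt (df κ ρ u) d' σ) :
    HasDerivAt (A₁f κ ρ t u) ((u ^ 2 + Complex.I * u) * (t : ℂ) / 2 * d' *
      Complex.cosh (df κ ρ u σ * (t : ℂ) / 2)) σ := by
  have hs := (Complex.hasDerivAt_sinh (df κ ρ u σ * (t : ℂ) / 2)).comp σ
    ((h.mul_const (t : ℂ)).div_const 2)
  exact (hs.const_mul (u ^ 2 + Complex.I * u)).congr_deriv (by ring)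

lemma hasDerivAt_A₂f {κ ρ t : ℝ} {u : ℂ} {σ : ℝ} {d' : ℂ} (h : HasDerivAt (df κ ρ u) d' σ) :
    HasDerivAt (A₂f κ ρ t u)
      (d' * (1 + ξf κ ρ u σ * t / 2) * Complex.cosh (df κ ρ u σ * (t : ℂ) / 2) +
        (df κ ρ u σ * d' * t / 2 - ρ * Complex.I * u) *
          Complex.sinh (df κ ρ u σ * (t : ℂ) / 2)) σ := by
  have hi := (h.mul_const (t : ℂ)).div_const 2
  have hs := (Complex.hasDerivAt_sinh (df κ ρ u σ * (t : ℂ) / 2)).comp σ hi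
  have hc := (Complex.hasDerivAt_cosh (df κ ρ u σ * (t : ℂ) / 2)).comp σ hi
  refine ((h.mul hc).add ((hasDerivAt_ξf κ ρ u σ).mul hs)).congr_deriv ?_
  simp only [Function.comp_apply]
  ring

lemma hasDerivAt_Dfn {κ ρ t : ℝ} {u : ℂ} {σ : ℝ} {d' A' : ℂ}
    (h : HasDerivAt (df κ ρ u) d' σ) (hA : HasDerivAt (A₂f κ ρ t u) A' σ)
    (hd : df κ ρ u σ ∈ Complex.slitPlane) (hX : Xf κ ρ t u σ ∈ Complex.slitPlane)
    (hA0 : A₂f κ ρ t u σ ≠ 0) :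
    HasDerivAt (Dfn κ ρ t u) (d' / df κ ρ u σ - A' / A₂f κ ρ t u σ) σ := by
  have hXd := hA.mul ((h.mul_const (t : ℂ)).div_const 2).neg.cexp
  replace hXd := hXd.congr_of_eventuallyEq
    (Filter.Eventually.of_forall (Xf_eq_A₂f_mul_exp κ ρ t u))
  have hD := ((h.clog_real hd).add (((h.const_sub (κ : ℂ)).mul_const (t : ℂ)).div_const 2)).sub
    (hXd.clog_real hX)
  refine hD.congr_deriv ?_
  rw [Xf_eq_A₂f_mul_exp]
  have hd0 := Complex.slitPlane_ne_zero hd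
  have he := Complex.exp_ne_zero (-(df κ ρ u σ * (t : ℂ) / 2))
  simp only [Pi.neg_apply]
  field_simp
  ring

/-- `∂φ/∂σ = φ·h₅` with
`h₅ = −v₀·Aσ' − (4κv̄/σ³)·D + (2κv̄/(σ²d))·(dσ' − (d/A₂)·A₂σ') + tκv̄ρiu/σ²`. -/
theorem hasDerivAt_heston_charFn_sigma (κ vb ρ v₀ r t S₀ : ℝ) (ht : 0 < t) (hS₀ : 0 < S₀)
    (u : ℂ) (hu : u ≠ 0) (σ₀ : ℝ) (hσ₀ : σ₀ ≠ 0)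
    (hw : (ξf κ ρ u σ₀) ^ 2 + (σ₀ : ℂ) ^ 2 * (u ^ 2 + Complex.I * u) ∈ Complex.slitPlane)
    (hd : df κ ρ u σ₀ ∈ Complex.slitPlane)
    (hX : Xf κ ρ t u σ₀ ∈ Complex.slitPlane)
    (hξ0 : ξf κ ρ u σ₀ ≠ 0) (hA₂0 : A₂f κ ρ t u σ₀ ≠ 0)
    (dσ' A₁ρ' A₂ρ' A₁σ' A₂σ' Aσ' h₅ : ℂ)
    (hdσ' : dσ' = (-(ξf κ ρ u σ₀) * (ρ : ℂ) * Complex.I * u +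
      (σ₀ : ℂ) * (u ^ 2 + Complex.I * u)) / df κ ρ u σ₀)
    (hA₁ρ' : A₁ρ' = -(Complex.I * u * (u ^ 2 + Complex.I * u) * (t : ℂ) * ξf κ ρ u σ₀ *
      (σ₀ : ℂ)) * Complex.cosh (df κ ρ u σ₀ * (t : ℂ) / 2) / (2 * df κ ρ u σ₀))
    (hA₂ρ' : A₂ρ' = -((σ₀ : ℂ) * Complex.I * u * (2 + (t : ℂ) * ξf κ ρ u σ₀)) *
      (ξf κ ρ u σ₀ * Complex.cosh (df κ ρ u σ₀ * (t : ℂ) / 2) +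
        df κ ρ u σ₀ * Complex.sinh (df κ ρ u σ₀ * (t : ℂ) / 2)) / (2 * df κ ρ u σ₀))
    (hA₁σ' : A₁σ' = (u ^ 2 + Complex.I * u) * (t : ℂ) / 2 * dσ' *
      Complex.cosh (df κ ρ u σ₀ * (t : ℂ) / 2))
    (hA₂σ' : A₂σ' = ((ρ : ℂ) / (σ₀ : ℂ)) * A₂ρ' -
      ((2 + (t : ℂ) * ξf κ ρ u σ₀) / (Complex.I * u * (t : ℂ) * ξf κ ρ u σ₀)) * A₁ρ' +
      (σ₀ : ℂ) * (t : ℂ) * A₁f κ ρ t u σ₀ / 2)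
    (hAσ' : Aσ' = (1 / A₂f κ ρ t u σ₀) * A₁σ' - (Af κ ρ t u σ₀ / A₂f κ ρ t u σ₀) * A₂σ')
    (hh₅ : h₅ = -(v₀ : ℂ) * Aσ' -
      (4 * (κ : ℂ) * (vb : ℂ) / (σ₀ : ℂ) ^ 3) * Dfn κ ρ t u σ₀ +
      (2 * (κ : ℂ) * (vb : ℂ) / ((σ₀ : ℂ) ^ 2 * df κ ρ u σ₀)) *
        (dσ' - (df κ ρ u σ₀ / A₂f κ ρ t u σ₀) * A₂σ') +
      (t : ℂ) * (κ : ℂ) * (vb : ℂ) * (ρ : ℂ) * Complex.I * u / (σ₀ : ℂ) ^ 2) :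
    HasDerivAt (φf κ vb ρ v₀ r t S₀ u) (φf κ vb ρ v₀ r t S₀ u σ₀ * h₅) σ₀ := by
  have hd0 : df κ ρ u σ₀ ≠ 0 := Complex.slitPlane_ne_zero hd
  have hσ : (σ₀ : ℂ) ≠ 0 := Complex.ofReal_ne_zero.mpr hσ₀
  have ht0 : (t : ℂ) ≠ 0 := Complex.ofReal_ne_zero.mpr ht.ne'
  have hdD : HasDerivAt (df κ ρ u) dσ' σ₀ := hdσ' ▸ hasDerivAt_df hw
  have hA₁D : HasDerivAt (A₁f κ ρ t u) A₁σ' σ₀ := hA₁σ' ▸ hasDerivAt_A₁f hdD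
  have hA₂D : HasDerivAt (A₂f κ ρ t u) A₂σ' σ₀ := by
    refine (hasDerivAt_A₂f hdD).congr_deriv ?_
    rw [hA₂σ', hA₂ρ', hA₁ρ', hdσ', A₁f]
    have hI := Complex.I_ne_zero
    field_simp
    ring
  have hAD : HasDerivAt (Af κ ρ t u) Aσ' σ₀ := by
    refine (hA₁D.div hA₂D hA₂0).congr_deriv ?_
    rw [hAσ', Af]
    field_simp
  have hDD := hasDerivAt_Dfn hdD hA₂D hd hX hA₂0
  have hid : HasDerivAt (fun x : ℝ => (x : ℂ)) 1 σ₀ := Complex.ofRealCLM.hasDerivAt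
  have hdrift := (hasDerivAt_const σ₀
    ((t : ℂ) * (κ : ℂ) * (vb : ℂ) * (ρ : ℂ) * Complex.I * u)).div hid hσ
  have hcoef := (hasDerivAt_const σ₀ (2 * (κ : ℂ) * (vb : ℂ))).div (hid.pow 2) (pow_ne_zero 2 hσ)
  have hφ := (((hdrift.const_sub
    (Complex.I * u * ((Real.log S₀ : ℂ) + (r : ℂ) * (t : ℂ)))).sub
    (hAD.const_mul (v₀ : ℂ))).add (hcoef.mul hDD)).cexp
  refine hφ.congr_deriv (congrArg (φf κ vb ρ v₀ r t S₀ u σ₀ * ·) ?_)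
  rw [hh₅]
  simp only [Pi.div_apply, Pi.pow_apply]
  field_simp
  simp
  ring
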